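/- Let m ≥ 3 and let ζ be a primitive m-th root of unity in ℂ. Then for all n ≥ 1, P_n^σ(ζ) ≠ 0, where P_n^σ are the D'Arcais polynomials. In particular P_n^σ(i) ≠ 0 and P_n^σ(−i) ≠ 0. -/

import Mathlib

open Polynomial

/-- The polynomials `P_n^g ∈ ℚ[X]` defined by `P_0^g = 1` and
`P_n^g = (x/n) ∑_{k=1}^n g(k) P_{n-k}^g` for `n ≥ 1`. -/
noncomputable def darcais (g : ℕ → ℤ) : ℕ → ℚ[X]
  | 0 => 1
  | n + 1 =>
      C (((n : ℚ) + 1)⁻¹) * X *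
        ∑ k ∈ Finset.range (n + 1), C ((g (k + 1) : ℚ)) * darcais g (n - k)
  decreasing_by exact Nat.sub_lt_succ n k

/-- `A_n^g := n! ⬝ P_n^g`. -/
noncomputable def darcaisA (g : ℕ → ℤ) (n : ℕ) : ℚ[X] :=
  (n.factorial : ℚ[X]) * darcais g n

/-- Sum-of-divisors function `σ` as a `ℤ`-valued arithmetic function. -/
def sigma' (n : ℕ) : ℤ := ∑ d ∈ n.divisors, (d : ℤ)

/-- The integer polynomials `n! ⬝ P_n^g`, defined by a division-free recursion. -/
noncomputable def darcaisInt (g : ℕ → ℤ) : ℕ → ℤ[X]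
  | 0 => 1
  | n + 1 =>
      X * ∑ k ∈ Finset.range (n + 1), C (g (k + 1) * (n.descFactorial k : ℤ)) * darcaisInt g (n - k)
  decreasing_by exact Nat.sub_lt_succ n k

theorem aeval_darcaisInt_succ {A : Type*} [CommRing A] (g : ℕ → ℤ) (y : A) (n : ℕ) :
    aeval y (darcaisInt g (n + 1)) =
      y * ∑ k ∈ Finset.range (n + 1),
        (g (k + 1) : A) * (n.descFactorial k : A) * aeval y (darcaisInt g (n - k)) := by
  rw [darcaisInt]
  simp [map_sum]

theorem map_darcaisInt (g : ℕ → ℤ) (n : ℕ) :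
    (darcaisInt g n).map (Int.castRingHom ℚ) = C (n.factorial : ℚ) * darcais g n := by
  induction n using Nat.strong_induction_on with
  | _ n ih =>
    cases n with
    | zero => simp [darcaisInt, darcais]
    | succ n =>
      have hfac : C ((n + 1).factorial : ℚ) * C (((n : ℚ) + 1)⁻¹) = C (n.factorial : ℚ) := by
        rw [← C_mul, Nat.factorial_succ]
        congr 1
        push_cast
        field_simp
      rw [darcaisInt, darcais, ← mul_assoc, ← mul_assoc, hfac, mul_right_comm, mul_comm _ X,
        Polynomial.map_mul, map_X, Polynomial.map_sum, Finset.mul_sum (a := C _)]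
      congr 1
      refine Finset.sum_congr rfl fun k hk ↦ ?_
      have hkn : k ≤ n := Nat.lt_succ_iff.mp (Finset.mem_range.mp hk)
      rw [Polynomial.map_mul, ih _ (by omega), ← Nat.factorial_mul_descFactorial hkn]
      simp only [Polynomial.map_mul, Polynomial.map_intCast, Polynomial.map_natCast, map_mul,
        eq_intCast, Nat.cast_mul, map_natCast, map_intCast]
      ring

theorem aeval_darcaisInt_complex (g : ℕ → ℤ) (ζ : ℂ) (n : ℕ) :
    aeval ζ (darcaisInt g n) = (n.factorial : ℂ) * aeval ζ (darcais g n) := by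
  have h := congrArg (aeval ζ) (map_darcaisInt g n)
  rw [map_mul, aeval_C] at h
  rw [← aeval_map_algebraMap ℚ]
  simpa using h

theorem natCast_descFactorial_add {A : Type*} [CommRing A] {p : ℕ} (hp : (p : A) = 0) (n k : ℕ) :
    ((n + p).descFactorial k : A) = (n.descFactorial k : A) := by
  rw [← descPochhammer_eval_eq_descFactorial, ← descPochhammer_eval_eq_descFactorial]
  simp [hp]

theorem aeval_darcaisInt_add {A : Type*} [CommRing A] {p : ℕ} (hp : (p : A) = 0) (g : ℕ → ℤ)
    (y : A) (n : ℕ) :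
    aeval y (darcaisInt g (n + p)) = aeval y (darcaisInt g n) * aeval y (darcaisInt g p) := by
  induction n using Nat.strong_induction_on with
  | _ n ih =>
    cases n with
    | zero => simp [darcaisInt]
    | succ n =>
      rw [show n + 1 + p = n + p + 1 by ring, aeval_darcaisInt_succ, aeval_darcaisInt_succ g y n,
        mul_assoc, Finset.sum_mul,
        ← Finset.sum_subset (Finset.range_subset_range.2 (by omega : n + 1 ≤ n + p + 1))]
      · congr 1
        refine Finset.sum_congr rfl fun k hk ↦ ?_
        have hkn : k ≤ n := Nat.lt_succ_iff.mp (Finset.mem_range.mp hk)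
        rw [natCast_descFactorial_add hp, show n + p - k = n - k + p by omega, ih _ (by omega)]
        ring
      · intro k _ hk
        rw [natCast_descFactorial_add hp, Nat.descFactorial_of_lt (by simpa using hk)]
        simp

theorem aeval_darcaisInt_sigma_one {A : Type*} [CommRing A] (y : A) :
    aeval y (darcaisInt sigma' 1) = y := by
  have h1 : sigma' 1 = 1 := by decide
  simp [darcaisInt, h1]

theorem aeval_darcaisInt_sigma_two {A : Type*} [CommRing A] (y : A) :
    aeval y (darcaisInt sigma' 2) = y * (y + 3) := by
  have h1 : sigma' 1 = 1 := by decide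
  have h2 : sigma' 2 = 3 := by decide
  simp [Finset.sum_range_succ, darcaisInt, h1, h2, map_ofNat (aeval y)]

theorem aeval_darcaisInt_sigma_three {A : Type*} [CommRing A] (y : A) :
    aeval y (darcaisInt sigma' 3) = y * (y + 1) * (y + 8) := by
  have h1 : sigma' 1 = 1 := by decide
  have h2 : sigma' 2 = 3 := by decide
  have h3 : sigma' 3 = 4 := by decide
  simp [Finset.sum_range_succ, darcaisInt, h1, h2, h3, Nat.descFactorial, map_ofNat (aeval y)]
  ring

theorem eq_one_of_aeval_darcaisInt_sigma_eq_zero {A : Type*} [CommRing A] [IsDomain A]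
    (h2 : (2 : A) = 0) {y : A} (hy : y ≠ 0) (n : ℕ) (h : aeval y (darcaisInt sigma' n) = 0) :
    y = 1 := by
  induction n using Nat.twoStepInduction with
  | zero => simp [darcaisInt] at h
  | one => exact absurd (by simpa [aeval_darcaisInt_sigma_one] using h) hy
  | more n ih _ =>
    rw [aeval_darcaisInt_add (by exact_mod_cast h2), aeval_darcaisInt_sigma_two] at h
    rcases mul_eq_zero.1 h with h | h
    · exact ih h
    · linear_combination (mul_eq_zero.1 h).resolve_left hy - 2 * h2

theorem sq_eq_one_of_aeval_darcaisInt_sigma_eq_zero {A : Type*} [CommRing A] [IsDomain A]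
    (h3 : (3 : A) = 0) {y : A} (hy : y ≠ 0) (n : ℕ) (h : aeval y (darcaisInt sigma' n) = 0) :
    y ^ 2 = 1 := by
  induction n using Nat.strong_induction_on with
  | _ n ih =>
    match n with
    | 0 => simp [darcaisInt] at h
    | 1 => exact absurd (by simpa [aeval_darcaisInt_sigma_one] using h) hy
    | 2 => simp [aeval_darcaisInt_sigma_two, h3, hy] at h
    | n + 3 =>
      rw [aeval_darcaisInt_add (by exact_mod_cast h3), aeval_darcaisInt_sigma_three] at h
      rcases mul_eq_zero.1 h with h | h
      · exact ih n (by omega) h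
      · have h' : (y + 1) * (y + 8) = 0 :=
          (mul_eq_zero.1 (by rwa [← mul_assoc])).resolve_left hy
        linear_combination h' - (3 * y + 3) * h3

theorem IsPrimitiveRoot.natCast_eq_zero_of_map_eq_one {R A : Type*} [CommRing R] [IsDomain R]
    [CommRing A] {ξ : R} {d : ℕ} (hξ : IsPrimitiveRoot ξ d) (hd : 1 < d) (φ : R →+* A)
    (h : φ ξ = 1) : (d : A) = 0 := by
  simpa [h] using congrArg φ (hξ.geom_sum_eq_zero hd)

/-- The ring of algebraic integers has a residue field of every prime characteristic. -/
theorem exists_isMaximal_natCast_mem_integralClosure {p : ℕ} (hp : p.Prime) :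
    ∃ M : Ideal (integralClosure ℤ ℂ), M.IsMaximal ∧ (p : integralClosure ℤ ℂ) ∈ M := by
  have hmax : (Ideal.span {(p : ℤ)}).IsMaximal :=
    PrincipalIdealRing.isMaximal_of_irreducible (Nat.prime_iff_prime_int.1 hp).irreducible
  obtain ⟨M, hM, hcomap⟩ := Ideal.exists_ideal_over_maximal_of_isIntegral
    (S := integralClosure ℤ ℂ) (Ideal.span {(p : ℤ)}) (by
      rw [(RingHom.injective_iff_ker_eq_bot _).1
        (FaithfulSMul.algebraMap_injective ℤ (integralClosure ℤ ℂ))]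
      exact bot_le)
  refine ⟨M, hM, ?_⟩
  have hmem : (p : ℤ) ∈ M.comap (algebraMap ℤ (integralClosure ℤ ℂ)) :=
    hcomap ▸ Ideal.mem_span_singleton_self _
  simpa using hmem

theorem natCast_ne_zero_of_coprime {A : Type*} [CommRing A] [Nontrivial A] {p q : ℕ}
    (hpq : p.Coprime q) (hp : (p : A) = 0) : (q : A) ≠ 0 := by
  intro hq
  have h := congrArg (Int.cast : ℤ → A) (Nat.gcd_eq_gcd_ab p q)
  rw [hpq] at h
  simp [hp, hq] at h

theorem aeval_darcaisInt_sigma_ne_zero {m : ℕ} (hm : 3 ≤ m) {z : integralClosure ℤ ℂ}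
    (hz : IsPrimitiveRoot z m) (n : ℕ) : aeval z (darcaisInt sigma' n) ≠ 0 := by
  intro h
  have hmap {A : Type} [CommRing A] (φ : integralClosure ℤ ℂ →+* A) :
      aeval (φ z) (darcaisInt sigma' n) = 0 := by
    have := congrArg φ.toIntAlgHom h
    rwa [← aeval_algHom_apply, map_zero] at this
  have hunit : IsUnit z := hz.isUnit (by omega)
  rcases Nat.eq_two_pow_or_exists_odd_prime_and_dvd m with ⟨k, rfl⟩ | ⟨q, hq, hqm, hodd⟩
  · obtain ⟨M, hM, h3⟩ := exists_isMaximal_natCast_mem_integralClosure Nat.prime_three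
    have h3' : (3 : integralClosure ℤ ℂ ⧸ M) = 0 := by
      simpa only [Nat.cast_ofNat, map_ofNat] using Ideal.Quotient.eq_zero_iff_mem.2 h3
    obtain _ | _ | k := k
    · omega
    · omega
    have hsq := sq_eq_one_of_aeval_darcaisInt_sigma_eq_zero h3'
      (hunit.map (Ideal.Quotient.mk M)).ne_zero n (hmap _)
    have hroot : IsPrimitiveRoot (z ^ 2) (2 ^ (k + 1)) :=
      hz.pow (by positivity) (by ring)
    refine natCast_ne_zero_of_coprime (p := 3) (Nat.Coprime.pow_right _ (by decide))
      (by exact_mod_cast h3')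
      (hroot.natCast_eq_zero_of_map_eq_one (Nat.one_lt_two_pow (by omega))
        (Ideal.Quotient.mk M) (by rw [map_pow, hsq]))
  · obtain ⟨M, hM, h2⟩ := exists_isMaximal_natCast_mem_integralClosure Nat.prime_two
    have h2' : (2 : integralClosure ℤ ℂ ⧸ M) = 0 := by
      simpa only [Nat.cast_ofNat, map_ofNat] using Ideal.Quotient.eq_zero_iff_mem.2 h2
    have hone := eq_one_of_aeval_darcaisInt_sigma_eq_zero h2'
      (hunit.map (Ideal.Quotient.mk M)).ne_zero n (hmap _)
    have hroot : IsPrimitiveRoot (z ^ (m / q)) q :=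
      hz.pow (by omega) (Nat.div_mul_cancel hqm).symm
    exact natCast_ne_zero_of_coprime (Nat.coprime_two_left.2 hodd) (by exact_mod_cast h2')
      (hroot.natCast_eq_zero_of_map_eq_one hq.one_lt (Ideal.Quotient.mk M)
        (by rw [map_pow, hone, one_pow]))

theorem aeval_darcais_sigma_ne_zero {m : ℕ} (hm : 3 ≤ m) {ζ : ℂ} (hζ : IsPrimitiveRoot ζ m)
    (n : ℕ) : aeval ζ (darcais sigma' n) ≠ 0 := by
  intro h
  let z : integralClosure ℤ ℂ := ⟨ζ, hζ.isIntegral (by omega)⟩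
  have hinj : Function.Injective (integralClosure ℤ ℂ).val := Subtype.val_injective
  have hz : IsPrimitiveRoot z m := IsPrimitiveRoot.of_map_of_injective
    (f := (integralClosure ℤ ℂ).val) hζ hinj
  refine aeval_darcaisInt_sigma_ne_zero hm hz n (hinj ?_)
  rw [← aeval_algHom_apply, map_zero]
  change aeval ζ (darcaisInt sigma' n) = 0
  rw [aeval_darcaisInt_complex, h, mul_zero]

/-- Theorem (Heim–Luca–Neuhauser): for `m ≥ 3` and `ζ` a primitive `m`-th root of
unity in `ℂ`, the D'Arcais polynomials satisfy `P_n^σ(ζ) ≠ 0` for all `n ≥ 1`;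
in particular `P_n^σ(±i) ≠ 0`. -/
theorem darcaisSigma_ne_zero_at_primitive_root (m : ℕ) (hm : 3 ≤ m)
    (ζ : ℂ) (hζ : IsPrimitiveRoot ζ m) (n : ℕ) (hn : 1 ≤ n) :
    aeval ζ (darcais sigma' n) ≠ 0 ∧
      aeval Complex.I (darcais sigma' n) ≠ 0 ∧
      aeval (-Complex.I) (darcais sigma' n) ≠ 0 := by
  have hI : IsPrimitiveRoot Complex.I 4 := Complex.isPrimitiveRoot_I
  refine ⟨aeval_darcais_sigma_ne_zero hm hζ n,
    aeval_darcais_sigma_ne_zero (by norm_num) hI n,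
    aeval_darcais_sigma_ne_zero (m := 4) (by norm_num) ?_ n⟩
  rw [← Complex.inv_I]
  exact hI.inv
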